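/- arXiv:1405.0847 — 8 statements merged into one kernel-verified Lean document; each statement's English description precedes it below -/
import Mathlib

section
/- Let (Σ,R) be a 2-balanced symmetric string rewriting system and let {a₁a₂, b₁b₂} be a rule of R with a₁ ≠ b₁ and a₂ ≠ b₂. Let Γ = Σ ∪ {X,Y} where X,Y are two new symbols not in Σ, and let S be the symmetric SRS over Γ obtained from R by removing the pair of rules (a₁a₂,b₁b₂), (b₁b₂,a₁a₂) and adding the rules {a₁a₂, Xa₂}, {Xa₂, XY}, {XY, b₁Y}, {b₁Y, b₁b₂} (each in both directions). Then for all words s,t ∈ Σ*, s ↔*_R t if and only if s ↔*_S t. -/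
/-- One rewriting step of a string rewriting system `R`: replace one occurrence of the
left-hand side of a rule by the right-hand side. -/
def RwStep {A : Type*} (R : Set (List A × List A)) (s t : List A) : Prop :=
  ∃ p ∈ R, ∃ u v : List A, s = u ++ p.1 ++ v ∧ t = u ++ p.2 ++ v

/-- The modified SRS `S` over `Γ = Σ ⊕ {X, Y}` (with `X = Sum.inr true`, `Y = Sum.inr false`):
`R` with the rule `{a₁a₂, b₁b₂}` removed (in both directions) and the rules
`{a₁a₂, Xa₂}, {Xa₂, XY}, {XY, b₁Y}, {b₁Y, b₁b₂}` added in both directions. -/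
def modifiedSRS {A : Type*} (R : Set (List A × List A)) (a1 a2 b1 b2 : A) :
    Set (List (A ⊕ Bool) × List (A ⊕ Bool)) :=
  (fun p : List A × List A => (p.1.map Sum.inl, p.2.map Sum.inl)) ''
      (R \ {([a1, a2], [b1, b2]), ([b1, b2], [a1, a2])}) ∪
    {([Sum.inl a1, Sum.inl a2], [Sum.inr true, Sum.inl a2]),
     ([Sum.inr true, Sum.inl a2], [Sum.inl a1, Sum.inl a2]),
     ([Sum.inr true, Sum.inl a2], [Sum.inr true, Sum.inr false]),
     ([Sum.inr true, Sum.inr false], [Sum.inr true, Sum.inl a2]),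
     ([Sum.inr true, Sum.inr false], [Sum.inl b1, Sum.inr false]),
     ([Sum.inl b1, Sum.inr false], [Sum.inr true, Sum.inr false]),
     ([Sum.inl b1, Sum.inr false], [Sum.inl b1, Sum.inl b2]),
     ([Sum.inl b1, Sum.inl b2], [Sum.inl b1, Sum.inr false])}

theorem RwStep.of_mem {A : Type*} {R : Set (List A × List A)} {p q : List A}
    (h : (p, q) ∈ R) (u v : List A) : RwStep R (u ++ p ++ v) (u ++ q ++ v) :=
  ⟨(p, q), h, u, v, rfl, rfl⟩

theorem RwStep.cons {A : Type*} {R : Set (List A × List A)} {s t : List A}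
    (h : RwStep R s t) (a : A) : RwStep R (a :: s) (a :: t) := by
  obtain ⟨p, hp, u, v, rfl, rfl⟩ := h
  exact ⟨p, hp, a :: u, v, rfl, rfl⟩

/-- Decode a word over `A ⊕ Bool`: `X` is read as `a1`, and `Y` is read as `a2` directly after
an `X` and as `b2` otherwise. The flag `x` records whether the preceding letter is `X`. -/
def decodeWord {A : Type*} (a1 a2 b2 : A) : Bool → List (A ⊕ Bool) → List A
  | _, [] => []
  | _, Sum.inl a :: w => a :: decodeWord a1 a2 b2 false w
  | _, Sum.inr true :: w => a1 :: decodeWord a1 a2 b2 true w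
  | x, Sum.inr false :: w => (if x then a2 else b2) :: decodeWord a1 a2 b2 false w

theorem decodeWord_map_inl {A : Type*} (a1 a2 b2 : A) (s : List A) (x : Bool) :
    decodeWord a1 a2 b2 x (s.map Sum.inl) = s := by
  induction s generalizing x with
  | nil => rfl
  | cons a s ih => simp [decodeWord, ih]

/-- If decoding the two sides of a rule in front of any suffix gives `R`-equivalent words,
then so does decoding them after any prefix. -/
theorem decodeWord_append_left {A : Type*} {R : Set (List A × List A)} {a1 a2 b2 : A}
    {s t : List (A ⊕ Bool)}
    (h : ∀ x, Relation.ReflTransGen (RwStep R)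
      (decodeWord a1 a2 b2 x s) (decodeWord a1 a2 b2 x t))
    (u : List (A ⊕ Bool)) (x : Bool) :
    Relation.ReflTransGen (RwStep R)
      (decodeWord a1 a2 b2 x (u ++ s)) (decodeWord a1 a2 b2 x (u ++ t)) := by
  induction u generalizing x with
  | nil => exact h x
  | cons c u ih =>
    rcases c with a | _ | _ <;> simp only [List.cons_append, decodeWord] <;>
      exact Relation.ReflTransGen.lift _ (fun _ _ hst => RwStep.cons hst _) _ _ (ih _)

theorem reflTransGen_decodeWord_of_rwStep {A : Type*} {R : Set (List A × List A)}
    (hsym : ∀ p ∈ R, (p.2, p.1) ∈ R)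
    (hbal : ∀ p ∈ R, p.1.length = 2 ∧ p.2.length = 2)
    {a1 a2 b1 b2 : A} (hrule : ([a1, a2], [b1, b2]) ∈ R)
    {s t : List (A ⊕ Bool)} (h : RwStep (modifiedSRS R a1 a2 b1 b2) s t) :
    Relation.ReflTransGen (RwStep R)
      (decodeWord a1 a2 b2 false s) (decodeWord a1 a2 b2 false t) := by
  obtain ⟨p, hp, u, v, rfl, rfl⟩ := h
  rw [List.append_assoc, List.append_assoc]
  refine decodeWord_append_left (fun x => ?_) u false
  rcases hp with ⟨⟨α, β⟩, ⟨hq, -⟩, rfl⟩ | hp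
  · obtain ⟨hα, hβ⟩ := hbal _ hq
    obtain ⟨c, d, rfl⟩ := List.length_eq_two.mp hα
    obtain ⟨e, f, rfl⟩ := List.length_eq_two.mp hβ
    exact .single (RwStep.of_mem hq [] _)
  · simp only [Set.mem_insert_iff, Set.mem_singleton_iff] at hp
    rcases hp with rfl | rfl | rfl | rfl | rfl | rfl | rfl | rfl
    · exact .refl
    · exact .refl
    · exact .refl
    · exact .refl
    · exact .single (RwStep.of_mem hrule [] _)
    · exact .single (RwStep.of_mem (hsym _ hrule) [] _)
    · exact .refl
    · exact .refl

theorem reflTransGen_modifiedSRS_of_rwStep {A : Type*} {R : Set (List A × List A)}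
    (a1 a2 b1 b2 : A) {s t : List A} (h : RwStep R s t) :
    Relation.ReflTransGen (RwStep (modifiedSRS R a1 a2 b1 b2))
      (s.map Sum.inl) (t.map Sum.inl) := by
  obtain ⟨p, hp, u, v, rfl, rfl⟩ := h
  simp only [List.map_append]
  have step {p q : List (A ⊕ Bool)} (h : (p, q) ∈ modifiedSRS R a1 a2 b1 b2) :=
    RwStep.of_mem h (u.map Sum.inl) (v.map Sum.inl)
  by_cases hrem : p ∈ ({([a1, a2], [b1, b2]), ([b1, b2], [a1, a2])} : Set (List A × List A))
  · rcases hrem with rfl | rfl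
    · exact (((Relation.ReflTransGen.single
        (step (q := [Sum.inr true, Sum.inl a2]) (by simp [modifiedSRS]))).tail
        (step (q := [Sum.inr true, Sum.inr false]) (by simp [modifiedSRS]))).tail
        (step (q := [Sum.inl b1, Sum.inr false]) (by simp [modifiedSRS]))).tail
        (step (by simp [modifiedSRS]))
    · exact (((Relation.ReflTransGen.single
        (step (q := [Sum.inl b1, Sum.inr false]) (by simp [modifiedSRS]))).tail
        (step (q := [Sum.inr true, Sum.inr false]) (by simp [modifiedSRS]))).tail
        (step (q := [Sum.inr true, Sum.inl a2]) (by simp [modifiedSRS]))).tail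
        (step (by simp [modifiedSRS]))
  · exact .single (step (Or.inl ⟨p, ⟨hp, hrem⟩, rfl⟩))

/-- Replacing a two-symbol-changing rule of a 2-balanced symmetric SRS by a sequence of
one-symbol-changing rules through two new intermediary symbols preserves the
reachability relation on words over the original alphabet. -/
theorem stmt0 {A : Type*} (R : Set (List A × List A))
    (hsym : ∀ p ∈ R, (p.2, p.1) ∈ R)
    (hbal : ∀ p ∈ R, p.1.length = 2 ∧ p.2.length = 2)
    (a1 a2 b1 b2 : A)
    (hrule : ([a1, a2], [b1, b2]) ∈ R)
    (h1 : a1 ≠ b1) (h2 : a2 ≠ b2) :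
    ∀ s t : List A,
      Relation.ReflTransGen (RwStep R) s t ↔
        Relation.ReflTransGen (RwStep (modifiedSRS R a1 a2 b1 b2))
          (s.map Sum.inl) (t.map Sum.inl) := by
  intro s t
  constructor
  · exact Relation.ReflTransGen.lift' (List.map Sum.inl)
      (fun _ _ => reflTransGen_modifiedSRS_of_rwStep a1 a2 b1 b2) s t
  · intro h
    have := Relation.ReflTransGen.lift' (decodeWord a1 a2 b2 false)
      (fun _ _ => reflTransGen_decodeWord_of_rwStep hsym hbal hrule) _ _ h
    simpa only [Function.onFun, decodeWord_map_inl] using this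
end

section
/- Let (Σ,R), the rule {a₁a₂, b₁b₂} with a₁ ≠ b₁ and a₂ ≠ b₂, Γ = Σ ∪ {X,Y}, and the symmetric SRS S over Γ be as follows: S is obtained from R by removing the rules (a₁a₂,b₁b₂), (b₁b₂,a₁a₂) and adding the rules {a₁a₂, Xa₂}, {Xa₂, XY}, {XY, b₁Y}, {b₁Y, b₁b₂} in both directions. Define φ : Γ* → Σ* by first replacing every occurrence of the subword XY by a₁a₂ (scanning left to right), then replacing every remaining occurrence of X by a₁ and every remaining occurrence of Y by b₂. Then for all u, u' ∈ Γ* with u ↔_S u' (a single rule application), either φ(u) = φ(u') or φ(u) ↔_R φ(u'); in particular φ(u) ↔*_R φ(u'). -/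
/-- The projection `φ : Γ* → Σ*`: scanning left to right, every occurrence of the subword
`XY` (i.e. `[Sum.inr true, Sum.inr false]`) is replaced by `a₁a₂`, then every remaining `X`
is replaced by `a₁` and every remaining `Y` by `b₂`. -/
def phiMap {A : Type*} (a1 a2 b2 : A) : List (A ⊕ Bool) → List A
  | [] => []
  | Sum.inr true :: Sum.inr false :: rest => a1 :: a2 :: phiMap a1 a2 b2 rest
  | Sum.inr true :: rest => a1 :: phiMap a1 a2 b2 rest
  | Sum.inr false :: rest => b2 :: phiMap a1 a2 b2 rest
  | Sum.inl c :: rest => c :: phiMap a1 a2 b2 rest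

/-- `phiMap` is multiplicative at any cut whose right-hand part does not begin with `Y`. -/
theorem phiMap_append {A : Type*} (a1 a2 b2 : A) (u w : List (A ⊕ Bool))
    (hw : w.head? ≠ some (Sum.inr false)) :
    phiMap a1 a2 b2 (u ++ w) = phiMap a1 a2 b2 u ++ phiMap a1 a2 b2 w := by
  fun_induction phiMap a1 a2 b2 u with
  | case1 => rfl
  | case2 rest ih => simp [phiMap, ih]
  | case3 rest hr ih =>
    rw [List.cons_append, List.cons_append, ← ih]
    refine phiMap.eq_3 _ _ _ _ fun t ht => ?_
    cases rest with
    | nil =>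
      rw [List.nil_append] at ht
      simp [ht] at hw
    | cons c rest =>
      rw [List.cons_append, List.cons.injEq] at ht
      exact hr rest (by rw [ht.1])
  | case4 rest ih => simp [phiMap, ih]
  | case5 c rest ih => simp [phiMap, ih]

/-- A two-letter word that starts with a letter other than `Y` and ends with a letter other
than `X` can be projected independently of its context. -/
theorem phiMap_append_pair_append {A : Type*} (a1 a2 b2 : A) (u v : List (A ⊕ Bool))
    (c d : A ⊕ Bool) (hc : c ≠ Sum.inr false) (hd : d ≠ Sum.inr true) :
    phiMap a1 a2 b2 (u ++ [c, d] ++ v) =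
      phiMap a1 a2 b2 u ++ phiMap a1 a2 b2 [c, d] ++ phiMap a1 a2 b2 v := by
  rw [List.append_assoc, phiMap_append _ _ _ _ _ (by simpa using hc), List.append_assoc]
  congr 1
  rcases c with c | _ | _ <;> rcases d with d | _ | _ <;> simp_all [phiMap]

/-- A single rule application in the modified system `S` projects under `φ` either to
equality or to a single rule application in `R`; in particular it projects to
`R`-reachability. -/
theorem stmt1 {A : Type*} (R : Set (List A × List A))
    (hsym : ∀ p ∈ R, (p.2, p.1) ∈ R)
    (hbal : ∀ p ∈ R, p.1.length = 2 ∧ p.2.length = 2)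
    (a1 a2 b1 b2 : A)
    (hrule : ([a1, a2], [b1, b2]) ∈ R)
    (h1 : a1 ≠ b1) (h2 : a2 ≠ b2) :
    ∀ u u' : List (A ⊕ Bool), RwStep (modifiedSRS R a1 a2 b1 b2) u u' →
      (phiMap a1 a2 b2 u = phiMap a1 a2 b2 u' ∨
        RwStep R (phiMap a1 a2 b2 u) (phiMap a1 a2 b2 u')) ∧
      Relation.ReflTransGen (RwStep R) (phiMap a1 a2 b2 u) (phiMap a1 a2 b2 u') := by
  intro u u' hstep
  have key : phiMap a1 a2 b2 u = phiMap a1 a2 b2 u' ∨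
      RwStep R (phiMap a1 a2 b2 u) (phiMap a1 a2 b2 u') := by
    obtain ⟨p, hp, x, y, rfl, rfl⟩ := hstep
    rcases hp with ⟨⟨l, r⟩, ⟨hR, -⟩, rfl⟩ | hp
    · obtain ⟨hl, hr⟩ := hbal _ hR
      obtain ⟨c, d, rfl⟩ := List.length_eq_two.mp hl
      obtain ⟨e, f, rfl⟩ := List.length_eq_two.mp hr
      refine Or.inr ⟨_, hR, phiMap a1 a2 b2 x, phiMap a1 a2 b2 y, ?_, ?_⟩ <;>
        simp only [List.map_cons, List.map_nil] <;>
        rw [phiMap_append_pair_append _ _ _ _ _ _ _ (by simp) (by simp)] <;>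
        simp [phiMap]
    · simp only [Set.mem_insert_iff, Set.mem_singleton_iff] at hp
      rcases hp with rfl | rfl | rfl | rfl | rfl | rfl | rfl | rfl <;>
        dsimp only <;>
        rw [phiMap_append_pair_append _ _ _ _ _ _ _ (by simp) (by simp),
          phiMap_append_pair_append _ _ _ _ _ _ _ (by simp) (by simp)]
      case inr.inr.inr.inr.inr.inl =>
        exact Or.inr ⟨_, hrule, phiMap a1 a2 b2 x, phiMap a1 a2 b2 y, by simp [phiMap], by simp [phiMap]⟩
      case inr.inr.inr.inr.inr.inr.inl =>
        exact Or.inr ⟨_, hsym _ hrule, phiMap a1 a2 b2 x, phiMap a1 a2 b2 y, by simp [phiMap], by simp [phiMap]⟩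
      all_goals exact Or.inl (by simp [phiMap])
  refine ⟨key, ?_⟩
  rcases key with h | h
  · rw [h]
  · exact Relation.ReflTransGen.single h
end

section
/- Let X be a set, f : X → X a function, and t ∈ X with f(t) = t. Then for every s ∈ X, the pair (s,t) lies in the reflexive transitive closure of the symmetric relation {(a,b) : f(a) = b or f(b) = a} if and only if f^[n](s) = t for some n ≥ 0 (where f^[n] denotes the n-fold iterate of f). In other words, for the functional relation given by f with fixed point t, reachability of t in the symmetric closure coincides with directed reachability of t. -/
/-- For the functional relation given by `f` with a fixed point `t`, reachability of `t`
in the reflexive transitive closure of the symmetric closure coincides with directed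
reachability of `t`, i.e. with `f^[n] s = t` for some `n ≥ 0`. -/
theorem stmt3 {X : Type*} (f : X → X) (t : X) (ht : f t = t) :
    ∀ s : X,
      Relation.ReflTransGen (fun a b => f a = b ∨ f b = a) s t ↔ ∃ n : ℕ, f^[n] s = t := by
  intro s
  constructor
  · intro h
    induction h using Relation.ReflTransGen.head_induction_on with
    | refl => exact ⟨0, rfl⟩
    | head hab _ ih =>
      obtain ⟨n, hn⟩ := ih
      rcases hab with rfl | rfl
      · exact ⟨n + 1, hn⟩
      · exact ⟨n, by rw [← Function.iterate_succ_apply, Function.iterate_succ_apply', hn, ht]⟩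
  · rintro ⟨n, hn⟩
    induction n generalizing s with
    | zero => exact hn ▸ .refl
    | succ n ih => exact .head (Or.inl rfl) (ih (f s) hn)
end

section
/- With the construction of the digraph H = (Δ,E) and the encoding ψ from a 2-balanced symmetric SRS (Γ,S) whose every rule changes only one of the two symbols (as in the previous statement): for every s ∈ Γⁿ the word ψ(s) is an H-word, and whenever s ↔_S t by a single application of a rule S_i = {a₁a₂, b₁a₂} with a₁ ≠ b₁ (or symmetrically a rule changing the second symbol), the H-words ψ(s) and ψ(t) are connected by a sequence of exactly 3 single-position changes through H-words: first change the pair symbol (a₁,a₂) at the rewritten position to x_i, then change the preceding pair symbol (c,a₁) to (c,b₁), then change x_i to (b₁,a₂). -/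
/-- The alphabet `Δ`: `Sum.inl (Sum.inl true)` is the special symbol `$`,
`Sum.inl (Sum.inl false)` is `¢`, `Sum.inl (Sum.inr i)` is `xᵢ`, and `Sum.inr (a, b)`
is the pair symbol `(a, b)` over `Γ ∪ {␣}`, where `none` stands for the blank `␣`. -/
abbrev DeltaSym (A : Type*) (m : ℕ) := (Bool ⊕ Fin m) ⊕ (Option A × Option A)

/-- The arcs `E` of the digraph `H = (Δ, E)` built from the rules `S₁, …, S_m`,
where rule `Sᵢ = {a₁a₂, b₁b₂}` is represented as `rules i = ((a₁, a₂), (b₁, b₂))`. -/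
def arcRel {A : Type*} {m : ℕ} (rules : Fin m → (A × A) × (A × A)) :
    DeltaSym A m → DeltaSym A m → Prop := fun d e =>
  (∃ (a : Option A) (b : A) (c : Option A),
      d = Sum.inr (a, some b) ∧ e = Sum.inr (some b, c)) ∨
  (∃ a : A, d = Sum.inl (Sum.inl true) ∧ e = Sum.inr (none, some a)) ∨
  (∃ a : A, d = Sum.inr (some a, none) ∧ e = Sum.inl (Sum.inl false)) ∨
  (∃ (i : Fin m) (c : Option A),
      (d = Sum.inr (c, some (rules i).1.1) ∨ d = Sum.inr (c, some (rules i).2.1)) ∧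
      e = Sum.inl (Sum.inr i)) ∨
  (∃ (i : Fin m) (c : Option A),
      d = Sum.inl (Sum.inr i) ∧
      (e = Sum.inr (some (rules i).1.2, c) ∨ e = Sum.inr (some (rules i).2.2, c)))

/-- The encoding `ψ(a₁…a_n) = $ (␣,a₁)(a₁,a₂)…(a_{n−1},a_n)(a_n,␣) ¢`. -/
def psiEnc {A : Type*} (m : ℕ) (w : List A) : List (DeltaSym A m) :=
  Sum.inl (Sum.inl true) ::
    ((List.zip ((none : Option A) :: w.map some) (w.map some ++ [none])).map Sum.inr ++
      [Sum.inl (Sum.inl false)])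

/-- Two words differ in exactly one position. -/
def OneDiff {D : Type*} (w w' : List D) : Prop :=
  ∃ (u : List D) (a b : D) (v : List D), a ≠ b ∧ w = u ++ a :: v ∧ w' = u ++ b :: v

/-- The part of `psiEnc` following the initial `$`, for a word preceded by the symbol `p`. -/
def psiTail {A : Type*} (m : ℕ) : Option A → List A → List (DeltaSym A m)
  | p, [] => [Sum.inr (p, none), Sum.inl (Sum.inl false)]
  | p, a :: w => Sum.inr (p, some a) :: psiTail m (some a) w

theorem psiEnc_eq_cons_psiTail {A : Type*} (m : ℕ) (w : List A) :
    psiEnc m w = Sum.inl (Sum.inl true) :: psiTail m none w := by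
  have h : ∀ p : Option A,
      (List.zip (p :: w.map some) (w.map some ++ [none])).map Sum.inr ++
        [Sum.inl (Sum.inl false)] = psiTail m p w := by
    induction w with
    | nil => intro p; rfl
    | cons a w ih => intro p; simpa [psiTail] using ih (some a)
  rw [psiEnc, h]

theorem psiTail_eq_cons {A : Type*} (m : ℕ) (w : List A) :
    ∃ (d : Option A) (r : List (DeltaSym A m)),
      ∀ p : Option A, psiTail m p w = Sum.inr (p, d) :: r := by
  cases w with
  | nil => exact ⟨_, _, fun _ => rfl⟩
  | cons a w => exact ⟨_, _, fun _ => rfl⟩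

theorem psiTail_append {A : Type*} (m : ℕ) (u : List A) :
    ∀ p : Option A, ∃ (l : List (DeltaSym A m)) (c : Option A), l.length = u.length ∧
      ∀ w : List A, psiTail m p (u ++ w) = l ++ psiTail m c w := by
  induction u with
  | nil => exact fun p => ⟨[], p, rfl, fun _ => rfl⟩
  | cons a u ih =>
    intro p
    obtain ⟨l, c, hl, h⟩ := ih (some a)
    exact ⟨Sum.inr (p, some a) :: l, c, by simp [hl], fun w => by simp [psiTail, h]⟩

/-- The encoding of `u a₁ a₂ v` has the form `l (c,a₁) (a₁,a₂) (a₂,d) r`, where `l`, `c`, `d`, `r`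
do not depend on `a₁` and `a₂`. -/
theorem psiEnc_append_pair_append {A : Type*} (m : ℕ) (u v : List A) :
    ∃ (l : List (DeltaSym A m)) (c d : Option A) (r : List (DeltaSym A m)),
      l.length = u.length + 1 ∧ ∀ a₁ a₂ : A, psiEnc m (u ++ [a₁, a₂] ++ v) =
        l ++ Sum.inr (c, some a₁) :: Sum.inr (some a₁, some a₂) :: Sum.inr (some a₂, d) :: r := by
  obtain ⟨l, c, hl, h⟩ := psiTail_append m u none
  obtain ⟨d, r, hr⟩ := psiTail_eq_cons m v
  refine ⟨Sum.inl (Sum.inl true) :: l, c, d, r, by simp [hl], fun a₁ a₂ => ?_⟩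
  rw [psiEnc_eq_cons_psiTail, List.append_assoc, h]
  simp [psiTail, hr]

theorem isChain_psiTail {A : Type*} {m : ℕ} (rules : Fin m → (A × A) × (A × A)) (w : List A) :
    ∀ a : A, (psiTail m (some a) w).IsChain (arcRel rules) := by
  induction w with
  | nil =>
    intro a
    simp [psiTail, arcRel]
  | cons b w ih =>
    intro a
    obtain ⟨d, r, hr⟩ := psiTail_eq_cons m w
    have h := ih b
    rw [psiTail]
    rw [hr] at h ⊢
    exact List.isChain_cons_cons.2 ⟨Or.inl ⟨_, _, _, rfl, rfl⟩, h⟩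

theorem isChain_psiEnc {A : Type*} {m : ℕ} (rules : Fin m → (A × A) × (A × A)) {s : List A}
    (hs : s ≠ []) : (psiEnc m s).IsChain (arcRel rules) := by
  obtain ⟨a, w, rfl⟩ := List.exists_cons_of_ne_nil hs
  obtain ⟨d, r, hr⟩ := psiTail_eq_cons m w
  have h := isChain_psiTail rules w a
  rw [psiEnc_eq_cons_psiTail, psiTail]
  rw [hr] at h ⊢
  exact List.isChain_cons_cons.2
    ⟨Or.inr (Or.inl ⟨_, rfl, rfl⟩), List.isChain_cons_cons.2 ⟨Or.inl ⟨_, _, _, rfl, rfl⟩, h⟩⟩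

theorem set_append_cons_cons {D : Type*} {n : ℕ} {l : List D} (hl : l.length = n + 1)
    (x y z : D) (r : List D) : (l ++ x :: y :: r).set (n + 2) z = l ++ x :: z :: r := by
  rw [List.set_append_right _ _ (by omega), hl, show n + 2 - (n + 1) = 1 by omega]
  rfl

theorem List.IsChain.replace_middle {D : Type*} {R : D → D → Prop} {l r : List D} {x y z y' : D}
    (h : (l ++ x :: y :: z :: r).IsChain R) (hx : R x y') (hz : R y' z) :
    (l ++ x :: y' :: z :: r).IsChain R := by
  rw [List.isChain_split] at h ⊢
  simp only [List.isChain_cons_cons] at h ⊢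
  exact ⟨h.1, hx, hz, h.2.2.2⟩

/-- Replacing the pair symbol of either side of the rule `Sᵢ` by `xᵢ` in an encoding yields an
`H`-word. -/
theorem isChain_set_psiEnc {A : Type*} {m : ℕ} (rules : Fin m → (A × A) × (A × A)) {i : Fin m}
    {a₁ a₂ : A} (h : (rules i).1 = (a₁, a₂) ∨ (rules i).2 = (a₁, a₂)) (u v : List A) :
    ((psiEnc m (u ++ [a₁, a₂] ++ v)).set (u.length + 2) (Sum.inl (Sum.inr i))).IsChain
      (arcRel rules) := by
  have hw := isChain_psiEnc rules (s := u ++ [a₁, a₂] ++ v) (by simp)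
  obtain ⟨l, c, d, r, hl, hpsi⟩ := psiEnc_append_pair_append m u v
  rw [hpsi] at hw ⊢
  rw [set_append_cons_cons hl]
  refine hw.replace_middle ?_ ?_
  · refine Or.inr (Or.inr (Or.inr (Or.inl ⟨i, c, ?_, rfl⟩)))
    rcases h with h | h <;> simp [h]
  · refine Or.inr (Or.inr (Or.inr (Or.inr ⟨i, d, rfl, ?_⟩)))
    rcases h with h | h <;> simp [h]

/-- (1) Encodings of nonempty words are `H`-words.
(2) A single application of a rule `Sᵢ` that changes only one of the two rewritten symbols
translates to exactly 3 single-position changes through `H`-words: first change the pair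
symbol at the rewritten position (list index `|u| + 2` of the encoding) to `xᵢ`, then
change the pair symbol recording the changed letter, then change `xᵢ` to the new pair
symbol. -/
theorem stmt5 {A : Type*} {m : ℕ} (rules : Fin m → (A × A) × (A × A))
    (hone : ∀ i, (rules i).1.1 = (rules i).2.1 ∨ (rules i).1.2 = (rules i).2.2) :
    (∀ s : List A, 1 ≤ s.length → (psiEnc m s).Chain' (arcRel rules)) ∧
    (∀ (i : Fin m) (a1 a2 b1 b2 : A) (u v : List A),
      (rules i = ((a1, a2), (b1, b2)) ∨ rules i = ((b1, b2), (a1, a2))) →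
      ((a1 = b1 ∧ a2 ≠ b2) ∨ (a2 = b2 ∧ a1 ≠ b1)) →
      ((psiEnc m (u ++ [a1, a2] ++ v)).set (u.length + 2)
          (Sum.inl (Sum.inr i))).Chain' (arcRel rules) ∧
      ((psiEnc m (u ++ [b1, b2] ++ v)).set (u.length + 2)
          (Sum.inl (Sum.inr i))).Chain' (arcRel rules) ∧
      OneDiff (psiEnc m (u ++ [a1, a2] ++ v))
        ((psiEnc m (u ++ [a1, a2] ++ v)).set (u.length + 2) (Sum.inl (Sum.inr i))) ∧
      OneDiff ((psiEnc m (u ++ [a1, a2] ++ v)).set (u.length + 2) (Sum.inl (Sum.inr i)))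
        ((psiEnc m (u ++ [b1, b2] ++ v)).set (u.length + 2) (Sum.inl (Sum.inr i))) ∧
      OneDiff ((psiEnc m (u ++ [b1, b2] ++ v)).set (u.length + 2) (Sum.inl (Sum.inr i)))
        (psiEnc m (u ++ [b1, b2] ++ v))) := by
  refine ⟨fun s hs => isChain_psiEnc rules (List.ne_nil_of_length_pos hs), ?_⟩
  intro i a1 a2 b1 b2 u v hi hne
  refine ⟨isChain_set_psiEnc rules ?_ u v, isChain_set_psiEnc rules ?_ u v, ?_⟩
  · rcases hi with hi | hi <;> simp [hi]
  · rcases hi with hi | hi <;> simp [hi]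
  obtain ⟨l, c, d, r, hl, hpsi⟩ := psiEnc_append_pair_append m u v
  simp only [hpsi, set_append_cons_cons hl]
  refine ⟨⟨l ++ [Sum.inr (c, some a1)], _, _, _,
      Sum.inr_ne_inl, List.append_cons .., List.append_cons ..⟩, ?_,
    ⟨l ++ [Sum.inr (c, some b1)], _, _, _,
      Sum.inl_ne_inr, List.append_cons .., List.append_cons ..⟩⟩
  rcases hne with ⟨rfl, hne⟩ | ⟨rfl, hne⟩
  · exact ⟨l ++ [Sum.inr (c, some a1), Sum.inl (Sum.inr i)], Sum.inr (some a2, d),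
      Sum.inr (some b2, d), r, by simpa using hne, by simp, by simp⟩
  · exact ⟨l, _, _, _, by simpa using hne, rfl, rfl⟩
end

section
/- Let H = (Σ, E_H) be a digraph and n ≥ 1. Let G_n be the simple graph with vertices v₀, v_{n+1} and v_iᵃ for i ∈ {1,…,n}, a ∈ Σ, and edges v₀v₁ᵃ and v_nᵃv_{n+1} for all a ∈ Σ, and v_iᵃ v_{i+1}ᵇ for all (a,b) ∈ E_H and i ∈ {1,…,n−1}. Then every path from v₀ to v_{n+1} in G_n has length at least n+1, and the map sending an H-word a₁…a_n of length n to the path v₀, v₁^{a₁}, v₂^{a₂}, …, v_n^{a_n}, v_{n+1} is a bijection between H-words of length n and paths of length n+1 (i.e., shortest paths) from v₀ to v_{n+1} in G_n. -/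
/-- The graph `G_n` for a digraph `H = (A, E)`: vertices `v₀ = Sum.inl false`,
`v_{n+1} = Sum.inl true` and `vᵢᵃ = Sum.inr (i, a)` (with `i : Fin n` zero-indexed, so
`Sum.inr (i, a)` is the paper's `v_{i+1}ᵃ`); edges `v₀v₁ᵃ`, `v_nᵃv_{n+1}` for all `a`,
and `vᵢᵃv_{i+1}ᵇ` for all arcs `(a, b)` of `E`. -/
def layerGraph {A : Type*} (E : A → A → Prop) (n : ℕ) :
    SimpleGraph (Bool ⊕ Fin n × A) :=
  SimpleGraph.fromRel fun x y =>
    (∃ (i : Fin n) (a : A), i.val = 0 ∧ x = Sum.inl false ∧ y = Sum.inr (i, a)) ∨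
    (∃ (i : Fin n) (a : A), i.val = n - 1 ∧ x = Sum.inr (i, a) ∧ y = Sum.inl true) ∨
    (∃ (i j : Fin n) (a b : A),
      j.val = i.val + 1 ∧ E a b ∧ x = Sum.inr (i, a) ∧ y = Sum.inr (j, b))

/-- The vertex sequence `v₀, v₁^{w₁}, …, v_n^{w_n}, v_{n+1}` corresponding to a word `w`. -/
def wordSupport {A : Type*} (n : ℕ) (w : List A) : List (Bool ⊕ Fin n × A) :=
  Sum.inl false :: ((List.finRange n).zip w).map Sum.inr ++ [Sum.inl true]

/-- The layer of a vertex of `layerGraph E n`. -/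
def vertexLayer {A : Type*} (n : ℕ) : Bool ⊕ Fin n × A → ℕ
  | Sum.inl false => 0
  | Sum.inl true => n + 1
  | Sum.inr (i, _) => i.val + 1

section LayerGraph

variable {A : Type*} {E : A → A → Prop} {n : ℕ}

theorem layerGraph_adj_start {i : Fin n} {a : A} (hi : i.val = 0) :
    (layerGraph E n).Adj (Sum.inl false) (Sum.inr (i, a)) :=
  (SimpleGraph.fromRel_adj _ _ _).2 ⟨by simp, Or.inl (Or.inl ⟨i, a, hi, rfl, rfl⟩)⟩

theorem layerGraph_adj_end {i : Fin n} {a : A} (hi : i.val + 1 = n) :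
    (layerGraph E n).Adj (Sum.inr (i, a)) (Sum.inl true) :=
  (SimpleGraph.fromRel_adj _ _ _).2
    ⟨by simp, Or.inl (Or.inr (Or.inl ⟨i, a, by omega, rfl, rfl⟩))⟩

theorem layerGraph_adj_step {i j : Fin n} {a b : A} (hij : j.val = i.val + 1) (hab : E a b) :
    (layerGraph E n).Adj (Sum.inr (i, a)) (Sum.inr (j, b)) := by
  refine (SimpleGraph.fromRel_adj _ _ _).2
    ⟨?_, Or.inl (Or.inr (Or.inr ⟨i, j, a, b, hij, hab, rfl, rfl⟩))⟩
  intro h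
  simp only [Sum.inr.injEq, Prod.mk.injEq] at h
  have := congrArg Fin.val h.1
  omega

theorem vertexLayer_le_succ_of_adj {x y : Bool ⊕ Fin n × A} (h : (layerGraph E n).Adj x y) :
    vertexLayer n y ≤ vertexLayer n x + 1 := by
  obtain ⟨-, h⟩ := (SimpleGraph.fromRel_adj _ _ _).1 h
  rcases h with (⟨i, a, hi, rfl, rfl⟩ | ⟨i, a, hi, rfl, rfl⟩ | ⟨i, j, a, b, hij, -, rfl, rfl⟩) |
      (⟨i, a, hi, rfl, rfl⟩ | ⟨i, a, hi, rfl, rfl⟩ | ⟨i, j, a, b, hij, -, rfl, rfl⟩) <;>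
    simp only [vertexLayer] <;> omega

theorem rel_of_layerGraph_adj {i j : Fin n} {a b : A} (hij : j.val = i.val + 1)
    (h : (layerGraph E n).Adj (Sum.inr (i, a)) (Sum.inr (j, b))) : E a b := by
  obtain ⟨-, h⟩ := (SimpleGraph.fromRel_adj _ _ _).1 h
  rcases h with (⟨_, _, _, h, _⟩ | ⟨_, _, _, _, h⟩ | ⟨i', j', a', b', hij', hab, h₁, h₂⟩) |
      (⟨_, _, _, h, _⟩ | ⟨_, _, _, _, h⟩ | ⟨i', j', a', b', hij', hab, h₁, h₂⟩)
  · cases h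
  · cases h
  · cases h₁
    cases h₂
    exact hab
  · cases h
  · cases h
  · cases h₁
    cases h₂
    omega

theorem vertexLayer_le_add_length {x y : Bool ⊕ Fin n × A} (p : (layerGraph E n).Walk x y) :
    vertexLayer n y ≤ vertexLayer n x + p.length := by
  induction p with
  | nil => simp
  | cons h q ih =>
    have := vertexLayer_le_succ_of_adj h
    rw [SimpleGraph.Walk.length_cons]
    omega

theorem drop_finRange_eq_cons (i : Fin n) :
    (List.finRange n).drop i.val = i :: (List.finRange n).drop (i.val + 1) := by
  rw [List.drop_eq_getElem_cons (by simp)]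
  simp

/-- A walk along increasing layers from `vᵢᵃ` to `v_{n+1}` spells a chain starting at `a`. -/
theorem exists_chain_of_walk {x y : Bool ⊕ Fin n × A} (p : (layerGraph E n).Walk x y)
    (hy : y = Sum.inl true) (i : Fin n) (a : A) (hx : x = Sum.inr (i, a))
    (hlen : p.length + i.val = n) :
    ∃ w : List A, (a :: w).length + i.val = n ∧ (a :: w).IsChain E ∧
      p.support =
        (((List.finRange n).drop i.val).zip (a :: w)).map Sum.inr ++ [Sum.inl true] := by
  induction p generalizing i a with
  | nil => simp [hy] at hx
  | @cons _ z _ h q ih =>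
    subst hx hy
    rw [SimpleGraph.Walk.length_cons] at hlen
    have h₁ := vertexLayer_le_succ_of_adj h
    have h₂ := vertexLayer_le_add_length q
    simp only [SimpleGraph.Walk.support_cons, drop_finRange_eq_cons i, List.zip_cons_cons,
      List.map_cons, List.cons_append]
    rcases z with (_ | _) | ⟨j, b⟩
    · simp only [vertexLayer] at h₂
      omega
    · simp only [vertexLayer] at h₁
      have hq : q.length = 0 := by omega
      refine ⟨[], by simp; omega, by simp, ?_⟩
      rw [(SimpleGraph.Walk.length_eq_zero_iff.1 hq).eq_nil]
      simp
    · simp only [vertexLayer] at h₁ h₂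
      have hj : j.val = i.val + 1 := by omega
      obtain ⟨w, hw, hc, hs⟩ := ih rfl j b rfl (by omega)
      refine ⟨b :: w, ?_, List.isChain_cons_cons.2 ⟨rel_of_layerGraph_adj hj h, hc⟩, ?_⟩
      · rw [List.length_cons]
        omega
      · rw [hs, hj]

/-- A chain starting at `a` spells a walk from `vᵢᵃ` to `v_{n+1}`. -/
theorem exists_walk_of_chain (w : List A) (i : Fin n) (a : A)
    (hlen : (a :: w).length + i.val = n) (hc : (a :: w).IsChain E) :
    ∃ p : (layerGraph E n).Walk (Sum.inr (i, a)) (Sum.inl true), p.support =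
      (((List.finRange n).drop i.val).zip (a :: w)).map Sum.inr ++ [Sum.inl true] := by
  induction w generalizing i a with
  | nil =>
    simp only [List.length_cons, List.length_nil] at hlen
    refine ⟨(layerGraph_adj_end (by omega)).toWalk, ?_⟩
    simp [drop_finRange_eq_cons i]
  | cons b w ih =>
    obtain ⟨hab, hc⟩ := List.isChain_cons_cons.1 hc
    simp only [List.length_cons] at hlen
    let j : Fin n := ⟨i.val + 1, by omega⟩
    obtain ⟨p, hp⟩ := ih j b (by simp only [List.length_cons, j]; omega) hc
    refine ⟨.cons (layerGraph_adj_step rfl hab) p, ?_⟩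
    rw [SimpleGraph.Walk.support_cons, hp, drop_finRange_eq_cons i]
    rfl

theorem length_wordSupport {w : List A} (hw : w.length = n) :
    (wordSupport n w).length = n + 2 := by
  simp [wordSupport, hw]

theorem nodup_wordSupport {w : List A} (hw : w.length = n) : (wordSupport n w).Nodup := by
  have hz : ((List.finRange n).zip w).Nodup := by
    apply List.Nodup.of_map Prod.fst
    rw [List.map_fst_zip (by simp [hw])]
    exact List.nodup_finRange n
  have := hz.map (f := (Sum.inr : _ → Bool ⊕ Fin n × A)) Sum.inr_injective
  simp [wordSupport, List.nodup_append, this]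

theorem wordSupport_injOn {w w' : List A} (hw : w.length = n) (hw' : w'.length = n)
    (h : wordSupport n w = wordSupport n w') : w = w' := by
  simp only [wordSupport, List.cons_append, List.cons.injEq, true_and,
    List.append_cancel_right_eq] at h
  have hz := congrArg (List.map Prod.snd) (List.map_injective_iff.2 Sum.inr_injective h)
  rwa [List.map_snd_zip (by simp [hw]), List.map_snd_zip (by simp [hw'])] at hz

end LayerGraph

/-- Every `v₀`–`v_{n+1}` path in `G_n` has length at least `n + 1`, and
`w ↦ (v₀, v₁^{w₁}, …, v_n^{w_n}, v_{n+1})` is a bijection between `H`-words of length `n`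
and paths of length `n + 1` (i.e. shortest paths) from `v₀` to `v_{n+1}`. -/
theorem stmt7 {A : Type*} (E : A → A → Prop) (n : ℕ) (hn : 1 ≤ n) :
    (∀ p : (layerGraph E n).Walk (Sum.inl false) (Sum.inl true),
        p.IsPath → n + 1 ≤ p.length) ∧
    (∀ w : List A, w.length = n → w.Chain' E →
      ∃! p : (layerGraph E n).Walk (Sum.inl false) (Sum.inl true),
        p.IsPath ∧ p.length = n + 1 ∧ p.support = wordSupport n w) ∧
    (∀ p : (layerGraph E n).Walk (Sum.inl false) (Sum.inl true),
        p.IsPath → p.length = n + 1 →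
      ∃! w : List A, w.length = n ∧ w.Chain' E ∧ p.support = wordSupport n w) := by
  refine ⟨fun p _ => ?_, fun w hw hc => ?_, fun p _ hp => ?_⟩
  · simpa [vertexLayer] using vertexLayer_le_add_length p
  · obtain ⟨p, hp⟩ : ∃ p : (layerGraph E n).Walk (Sum.inl false) (Sum.inl true),
        p.support = wordSupport n w := by
      cases w with
      | nil => simp at hw; omega
      | cons a w =>
        obtain ⟨p, hp⟩ := exists_walk_of_chain w ⟨0, hn⟩ a (by simpa using hw) hc
        refine ⟨.cons (layerGraph_adj_start rfl) p, ?_⟩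
        rw [SimpleGraph.Walk.support_cons, hp]
        rfl
    refine ⟨p, ⟨?_, ?_, hp⟩, fun q hq => SimpleGraph.Walk.ext_support (hq.2.2.trans hp.symm)⟩
    · rw [SimpleGraph.Walk.isPath_def, hp]
      exact nodup_wordSupport hw
    · have := p.length_support
      rw [hp, length_wordSupport hw] at this
      omega
  · obtain ⟨w, hw, hc, hs⟩ : ∃ w : List A, w.length = n ∧ w.IsChain E ∧
        p.support = wordSupport n w := by
      cases p with
      | @cons _ z _ h q =>
        rw [SimpleGraph.Walk.length_cons] at hp
        have h₁ := vertexLayer_le_succ_of_adj h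
        have h₂ := vertexLayer_le_add_length q
        rcases z with (_ | _) | ⟨i, a⟩
        · simp only [vertexLayer] at h₂
          omega
        · simp only [vertexLayer] at h₁
          omega
        · simp only [vertexLayer] at h₁
          have hi : i.val = 0 := by omega
          obtain ⟨w, hw, hc, hs⟩ := exists_chain_of_walk q rfl i a rfl (by omega)
          refine ⟨a :: w, by omega, hc, ?_⟩
          rw [SimpleGraph.Walk.support_cons, hs, hi]
          rfl
    exact ⟨w, ⟨hw, hc, hs⟩, fun w' h => wordSupport_injOn h.1 hw (h.2.2.symm.trans hs)⟩
end

section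
/- Let H = (Σ, E_H) be a digraph and n ≥ 1. Let G′_n be the simple graph with vertices v_iᵃ for i ∈ {1,…,n}, a ∈ Σ, whose edges are: all pairs of distinct vertices within each set V_i = {v_iᵃ : a ∈ Σ} (so each V_i is a clique), and v_iᵃ v_{i+1}ᵇ for all (a,b) ∉ E_H and i ∈ {1,…,n−1}. Then every independent set of G′_n contains at most one vertex from each V_i (hence has size at most n), and the map sending an H-word a₁…a_n to {v₁^{a₁}, …, v_n^{a_n}} is a bijection between H-words of length n and independent sets of size n in G′_n. -/
/-- The graph `G′_n` for a digraph `H = (A, E)`: vertices `vᵢᵃ = (i, a)` (with `i : Fin n`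
zero-indexed), each layer `Vᵢ = {(i, a) : a ∈ A}` a clique, and edges `vᵢᵃv_{i+1}ᵇ` for all
non-arcs `(a, b) ∉ E`. -/
def compLayerGraph {A : Type*} (E : A → A → Prop) (n : ℕ) : SimpleGraph (Fin n × A) :=
  SimpleGraph.fromRel fun x y =>
    x.1 = y.1 ∨ (y.1.val = x.1.val + 1 ∧ ¬E x.2 y.2)

/-- The set of vertices `{v₁^{w₁}, …, v_n^{w_n}}` corresponding to a word `w`. -/
def wordTokens {A : Type*} [DecidableEq A] (n : ℕ) (w : List A) : Finset (Fin n × A) :=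
  ((List.finRange n).zip w).toFinset

/-- A set of pairwise non-adjacent vertices. -/
def IsIndepFinset {V : Type*} (G : SimpleGraph V) (s : Finset V) : Prop :=
  ∀ u ∈ s, ∀ v ∈ s, u ≠ v → ¬G.Adj u v

theorem compLayerGraph_adj {A : Type*} (E : A → A → Prop) (n : ℕ) (x y : Fin n × A) :
    (compLayerGraph E n).Adj x y ↔ x ≠ y ∧
      ((x.1 = y.1 ∨ (y.1.val = x.1.val + 1 ∧ ¬E x.2 y.2)) ∨
        (y.1 = x.1 ∨ (x.1.val = y.1.val + 1 ∧ ¬E y.2 x.2))) :=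
  SimpleGraph.fromRel_adj _ x y

theorem wordTokens_ofFn {A : Type*} [DecidableEq A] {n : ℕ} (f : Fin n → A) :
    wordTokens n (List.ofFn f) = Finset.univ.image fun i => (i, f i) := by
  have h : (List.finRange n).zip (List.ofFn f) = (List.finRange n).map fun i => (i, f i) := by
    apply List.ext_getElem <;> simp
  ext x
  simp [wordTokens, h]

theorem mem_wordTokens_ofFn {A : Type*} [DecidableEq A] {n : ℕ} (f : Fin n → A)
    (x : Fin n × A) : x ∈ wordTokens n (List.ofFn f) ↔ f x.1 = x.2 := by
  obtain ⟨i, a⟩ := x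
  simp [wordTokens_ofFn]

theorem card_wordTokens_ofFn {A : Type*} [DecidableEq A] {n : ℕ} (f : Fin n → A) :
    (wordTokens n (List.ofFn f)).card = n := by
  rw [wordTokens_ofFn, Finset.card_image_of_injective _ fun i j h => congrArg Prod.fst h]
  simp

theorem List.exists_eq_ofFn_of_length_eq {A : Type*} {n : ℕ} {w : List A} (hw : w.length = n) :
    ∃ f : Fin n → A, w = List.ofFn f := by
  subst hw
  exact ⟨w.get, (List.ofFn_get w).symm⟩

theorem IsIndepFinset.injOn_fst {A : Type*} {E : A → A → Prop} {n : ℕ} {s : Finset (Fin n × A)}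
    (hs : IsIndepFinset (compLayerGraph E n) s) : Set.InjOn Prod.fst (s : Set (Fin n × A)) := by
  intro x hx y hy hxy
  by_contra hne
  exact hs x hx y hy hne ((compLayerGraph_adj E n x y).2 ⟨hne, .inl (.inl hxy)⟩)

/-- The vertex set of a word is independent exactly when the word is an `H`-word. -/
theorem isIndepFinset_wordTokens_ofFn {A : Type*} [DecidableEq A] (E : A → A → Prop) {n : ℕ}
    (f : Fin n → A) :
    IsIndepFinset (compLayerGraph E n) (wordTokens n (List.ofFn f)) ↔
      (List.ofFn f).IsChain E := by
  rw [List.isChain_iff_getElem]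
  simp only [List.length_ofFn, List.getElem_ofFn]
  constructor
  · intro h i hi
    by_contra hE
    have hne : ((⟨i, by omega⟩, f ⟨i, by omega⟩) : Fin n × A) ≠ (⟨i + 1, hi⟩, f ⟨i + 1, hi⟩) := by
      simp
    exact h _ ((mem_wordTokens_ofFn f _).2 rfl) _ ((mem_wordTokens_ofFn f _).2 rfl) hne
      ((compLayerGraph_adj E n _ _).2 ⟨hne, .inl (.inr ⟨rfl, hE⟩)⟩)
  · intro h
    have key : ∀ i j : Fin n, j.val = i.val + 1 → E (f i) (f j) := by
      rintro ⟨i, hi⟩ ⟨j, hj⟩ rfl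
      exact h i hj
    rintro ⟨i, a⟩ hx ⟨j, b⟩ hy hne hadj
    rw [mem_wordTokens_ofFn] at hx hy
    dsimp only at hx hy
    subst hx hy
    have hij : i ≠ j := by
      rintro rfl
      exact hne rfl
    rcases ((compLayerGraph_adj E n _ _).1 hadj).2 with (h | ⟨h, hE⟩) | (h | ⟨h, hE⟩)
    · exact hij h
    · exact hE (key i j h)
    · exact hij h.symm
    · exact hE (key j i h)

/-- Every independent set of `G′_n` has at most one vertex in each layer (hence size at
most `n`), and `w ↦ {v₁^{w₁}, …, v_n^{w_n}}` is a bijection between `H`-words of length `n`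
and independent sets of size `n` in `G′_n`. -/
theorem stmt9 {A : Type*} [DecidableEq A] (E : A → A → Prop) (n : ℕ) (hn : 1 ≤ n) :
    (∀ s : Finset (Fin n × A), IsIndepFinset (compLayerGraph E n) s →
      (∀ i : Fin n, (s.filter fun x => x.1 = i).card ≤ 1) ∧ s.card ≤ n) ∧
    (∀ w : List A, w.length = n → w.Chain' E →
      IsIndepFinset (compLayerGraph E n) (wordTokens n w) ∧ (wordTokens n w).card = n) ∧
    (∀ w w' : List A, w.length = n → w'.length = n →
      wordTokens n w = wordTokens n w' → w = w') ∧
    (∀ s : Finset (Fin n × A), IsIndepFinset (compLayerGraph E n) s → s.card = n →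
      ∃ w : List A, w.length = n ∧ w.Chain' E ∧ s = wordTokens n w) := by
  refine ⟨fun s hs => ⟨fun i => ?_, ?_⟩, fun w hw hc => ?_, fun w w' hw hw' h => ?_,
    fun s hs hcard => ?_⟩
  · refine Finset.card_le_one.2 fun x hx y hy => ?_
    rw [Finset.mem_filter] at hx hy
    exact hs.injOn_fst hx.1 hy.1 (hx.2.trans hy.2.symm)
  · rw [← Finset.card_image_of_injOn hs.injOn_fst]
    simpa using Finset.card_le_univ (s.image Prod.fst)
  · obtain ⟨f, rfl⟩ := List.exists_eq_ofFn_of_length_eq hw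
    exact ⟨(isIndepFinset_wordTokens_ofFn E f).2 hc, card_wordTokens_ofFn f⟩
  · obtain ⟨f, rfl⟩ := List.exists_eq_ofFn_of_length_eq hw
    obtain ⟨g, rfl⟩ := List.exists_eq_ofFn_of_length_eq hw'
    congr 1
    funext i
    have hi : (i, f i) ∈ wordTokens n (List.ofFn g) := h ▸ (mem_wordTokens_ofFn f _).2 rfl
    exact ((mem_wordTokens_ofFn g _).1 hi).symm
  · have himage : s.image Prod.fst = Finset.univ := by
      rw [← Finset.card_eq_iff_eq_univ, Finset.card_image_of_injOn hs.injOn_fst, hcard,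
        Fintype.card_fin]
    have hex : ∀ i : Fin n, ∃ a, (i, a) ∈ s := by
      intro i
      obtain ⟨⟨j, a⟩, hx, rfl⟩ := Finset.mem_image.1 (himage ▸ Finset.mem_univ i)
      exact ⟨a, hx⟩
    choose f hf using hex
    have hsub : wordTokens n (List.ofFn f) ⊆ s := by
      intro x hx
      rw [mem_wordTokens_ofFn] at hx
      have := hf x.1
      rwa [hx] at this
    have heq : s = wordTokens n (List.ofFn f) :=
      (Finset.eq_of_subset_of_card_le hsub (by rw [hcard, card_wordTokens_ofFn])).symm
    refine ⟨List.ofFn f, List.length_ofFn, ?_, heq⟩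
    exact (isIndepFinset_wordTokens_ofFn E f).1 (heq ▸ hs)
end

section
/- Let H = (Σ, E_H) be a digraph, n ≥ 1, and let G′_n be the simple graph with vertices v_iᵃ (i ∈ {1,…,n}, a ∈ Σ), edges between all pairs of distinct vertices within each V_i = {v_iᵃ : a ∈ Σ}, and edges v_iᵃ v_{i+1}ᵇ for all (a,b) ∉ E_H. For an H-word w of length n let I_w = {v₁^{w₁}, …, v_n^{w_n}}. Call two independent sets of size n adjacent (a token jump) if one is obtained from the other by removing one vertex and adding one vertex. Then for all H-words s,t of length n: I_s and I_t are connected by a sequence of size-n independent sets of G′_n in which consecutive sets are adjacent, if and only if s and t are connected by H-word reconfiguration. -/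
/-- Adjacency of `H`-words: both are `H`-words and they differ in exactly one position. -/
def HWordAdj {D : Type*} (E : D → D → Prop) (w w' : List D) : Prop :=
  w.Chain' E ∧ w'.Chain' E ∧ OneDiff w w'

/-- Token-jump adjacency of size-`n` independent sets: both are independent sets of size
`n` and one is obtained from the other by removing one vertex and adding one vertex. -/
def TokenJumpAdj {A : Type*} [DecidableEq A] (E : A → A → Prop) (n : ℕ)
    (s s' : Finset (Fin n × A)) : Prop :=
  IsIndepFinset (compLayerGraph E n) s ∧ IsIndepFinset (compLayerGraph E n) s' ∧
    s.card = n ∧ s'.card = n ∧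
    ∃ x ∈ s, ∃ y ∉ s, s' = insert y (s.erase x)

theorem oneDiff_iff_exists_set {D : Type*} {w w' : List D} :
    OneDiff w w' ↔ ∃ (i : ℕ) (a b : D), w[i]? = some a ∧ a ≠ b ∧ w' = w.set i b := by
  constructor
  · rintro ⟨u, a, b, v, hab, rfl, rfl⟩
    exact ⟨u.length, a, b, by simp, hab, by simp⟩
  · rintro ⟨i, a, b, ha, hab, rfl⟩
    obtain ⟨hi, rfl⟩ := List.getElem?_eq_some_iff.1 ha
    refine ⟨w.take i, w[i], b, w.drop (i + 1), hab, by simp, ?_⟩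
    rw [List.set_eq_take_append_cons_drop, if_pos hi]

section WordTokens

variable {A : Type*} [DecidableEq A] {E : A → A → Prop} {n : ℕ}

theorem mem_wordTokens {w : List A} {x : Fin n × A} :
    x ∈ wordTokens n w ↔ w[x.1.val]? = some x.2 := by
  obtain ⟨i, a⟩ := x
  simp only [wordTokens, List.mem_toFinset, List.mem_iff_getElem?, List.getElem?_zip_eq_some]
  constructor
  · rintro ⟨k, h, h'⟩
    obtain ⟨hk, rfl⟩ := List.getElem?_eq_some_iff.1 h
    simpa using h'
  · intro h
    exact ⟨i, by simp, h⟩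

theorem wordTokens_injective {w w' : List A} (hw : w.length = n) (hw' : w'.length = n)
    (h : wordTokens n w = wordTokens n w') : w = w' := by
  refine List.ext_getElem (hw.trans hw'.symm) fun i hi hi' => ?_
  have hm : ((⟨i, hw ▸ hi⟩ : Fin n), w[i]) ∈ wordTokens n w' := by
    rw [← h, mem_wordTokens]
    simp
  rw [mem_wordTokens] at hm
  simpa [hi', eq_comm] using hm

theorem card_wordTokens {w : List A} (hw : w.length = n) : (wordTokens n w).card = n := by
  rw [wordTokens, List.toFinset_card_of_nodup]
  · simp [hw]
  · refine List.Nodup.of_map Prod.fst ?_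
    rw [List.map_fst_zip (by simp [hw])]
    exact List.nodup_finRange n

theorem isIndepFinset_wordTokens {w : List A} (hw : w.length = n) :
    IsIndepFinset (compLayerGraph E n) (wordTokens n w) ↔ w.IsChain E := by
  rw [List.isChain_iff_getElem]
  constructor
  · intro h i hi
    by_contra hE
    refine h (⟨i, by omega⟩, w[i]) (by simp [mem_wordTokens]) (⟨i + 1, by omega⟩, w[i + 1])
      (by simp [mem_wordTokens]) (by simp) ?_
    rw [compLayerGraph, SimpleGraph.fromRel_adj]
    exact ⟨by simp, Or.inl (Or.inr ⟨rfl, hE⟩)⟩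
  · rintro h ⟨i, a⟩ hu ⟨j, b⟩ hv hne hadj
    rw [mem_wordTokens] at hu hv
    rw [compLayerGraph, SimpleGraph.fromRel_adj] at hadj
    dsimp only at hu hv hadj
    obtain ⟨hi, rfl⟩ := List.getElem?_eq_some_iff.1 hu
    obtain ⟨hj, rfl⟩ := List.getElem?_eq_some_iff.1 hv
    rcases hadj.2 with (rfl | ⟨hij, hE⟩) | (rfl | ⟨hij, hE⟩)
    · exact hne rfl
    · have := h i (by omega)
      simp only [← hij] at this
      exact hE this
    · exact hne rfl
    · have := h j (by omega)
      simp only [← hij] at this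
      exact hE this

theorem IsIndepFinset.exists_eq_wordTokens {S : Finset (Fin n × A)}
    (hS : IsIndepFinset (compLayerGraph E n) S) (hc : S.card = n) :
    ∃ w : List A, w.length = n ∧ S = wordTokens n w := by
  have hinj : Set.InjOn Prod.fst (S : Set (Fin n × A)) := by
    intro x hx y hy hxy
    by_contra hne
    refine hS x hx y hy hne ?_
    rw [compLayerGraph, SimpleGraph.fromRel_adj]
    exact ⟨hne, Or.inl (Or.inl hxy)⟩
  have himg : S.image Prod.fst = Finset.univ := by
    rw [← Finset.card_eq_iff_eq_univ, Finset.card_image_of_injOn hinj, hc, Fintype.card_fin]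
  have hex : ∀ i : Fin n, ∃ a, (i, a) ∈ S := fun i => by
    simpa [himg] using Finset.mem_image (f := Prod.fst) (s := S) (b := i)
  choose f hf using hex
  refine ⟨List.ofFn f, by simp, ?_⟩
  symm
  refine Finset.eq_of_subset_of_card_le ?_ (by rw [hc, card_wordTokens (by simp)])
  rintro ⟨i, a⟩ hx
  rw [mem_wordTokens] at hx
  simp only [List.getElem?_ofFn, Fin.is_lt, dif_pos, Option.some.injEq] at hx
  exact hx ▸ hf i

theorem wordTokens_set {w : List A} {i : Fin n} {a b : A}
    (ha : w[i.val]? = some a) :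
    wordTokens n (w.set i b) = insert (i, b) ((wordTokens n w).erase (i, a)) := by
  ext ⟨j, c⟩
  simp only [mem_wordTokens, Finset.mem_insert, Finset.mem_erase, List.getElem?_set,
    Prod.mk.injEq, Fin.ext_iff, ne_eq]
  grind

theorem tokenJumpAdj_wordTokens {w w' : List A} (hw : w.length = n) (hw' : w'.length = n) :
    TokenJumpAdj E n (wordTokens n w) (wordTokens n w') ↔ HWordAdj E w w' := by
  rw [TokenJumpAdj, HWordAdj, isIndepFinset_wordTokens hw, isIndepFinset_wordTokens hw',
    oneDiff_iff_exists_set]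
  refine and_congr_right fun _ => and_congr_right fun _ => ?_
  constructor
  · rintro ⟨-, -, ⟨i, a⟩, hx, ⟨j, b⟩, hy, heq⟩
    have hi := i.isLt
    have hij : i = j := by
      have hm : (i, w'[i.val]) ∈ wordTokens n w' := by simp [mem_wordTokens]
      rw [heq, Finset.mem_insert, Finset.mem_erase] at hm
      rw [mem_wordTokens] at hx
      rcases hm with hm | ⟨hne, hm⟩
      · exact congrArg Prod.fst hm
      · rw [mem_wordTokens] at hm
        exact absurd (congrArg (Prod.mk i) (Option.some.inj (hm.symm.trans hx))) hne
    subst hij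
    rw [mem_wordTokens] at hx hy
    refine ⟨i, a, b, hx, fun hab => hy (hab ▸ hx), ?_⟩
    exact wordTokens_injective hw' (by simpa using hw) (heq.trans (wordTokens_set hx).symm)
  · rintro ⟨i, a, b, ha, hab, rfl⟩
    have hi : i < n := hw ▸ (List.getElem?_eq_some_iff.1 ha).1
    refine ⟨card_wordTokens hw, card_wordTokens hw', (⟨i, hi⟩, a), mem_wordTokens.2 ha,
      (⟨i, hi⟩, b), ?_, wordTokens_set (i := ⟨i, hi⟩) ha⟩
    rw [mem_wordTokens]
    simpa [ha] using hab

end WordTokens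

theorem HWordAdj.length_eq {D : Type*} {E : D → D → Prop} {w w' : List D}
    (h : HWordAdj E w w') : w'.length = w.length := by
  obtain ⟨-, -, u, a, b, v, -, rfl, rfl⟩ := h
  simp

/-- The independent sets `I_s` and `I_t` corresponding to `H`-words `s` and `t` are
connected by a sequence of size-`n` independent sets of `G′_n` with consecutive ones
related by a token jump, if and only if `s` and `t` are connected by `H`-word
reconfiguration. -/
theorem stmt10 {A : Type*} [DecidableEq A] (E : A → A → Prop) (n : ℕ) (hn : 1 ≤ n)
    (s t : List A) (hs : s.length = n) (hsc : s.Chain' E)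
    (ht : t.length = n) (htc : t.Chain' E) :
    Relation.ReflTransGen (TokenJumpAdj E n) (wordTokens n s) (wordTokens n t) ↔
      Relation.ReflTransGen (HWordAdj E) s t := by
  constructor
  · intro h
    have key : ∀ S, Relation.ReflTransGen (TokenJumpAdj E n) (wordTokens n s) S →
        ∃ w : List A, w.length = n ∧ S = wordTokens n w ∧
          Relation.ReflTransGen (HWordAdj E) s w := by
      intro S hS
      induction hS with
      | refl => exact ⟨s, hs, rfl, .refl⟩
      | tail _ hadj ih =>
        obtain ⟨w, hw, rfl, hsw⟩ := ih
        obtain ⟨w', hw', rfl⟩ := hadj.2.1.exists_eq_wordTokens hadj.2.2.2.1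
        exact ⟨w', hw', rfl, hsw.tail ((tokenJumpAdj_wordTokens hw hw').1 hadj)⟩
    obtain ⟨w, hw, heq, hsw⟩ := key _ h
    exact wordTokens_injective ht hw heq ▸ hsw
  · intro h
    have key : ∀ w, Relation.ReflTransGen (HWordAdj E) s w →
        w.length = n ∧ Relation.ReflTransGen (TokenJumpAdj E n) (wordTokens n s)
          (wordTokens n w) := by
      intro w hw
      induction hw with
      | refl => exact ⟨hs, .refl⟩
      | tail _ hadj ih =>
        have hl := hadj.length_eq.trans ih.1
        exact ⟨hl, ih.2.tail ((tokenJumpAdj_wordTokens ih.1 hl).2 hadj)⟩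
    exact (key t h).2
end

section
/- Let H = (Σ, E_H) be a digraph, b = |Σ² \ E_H|, and n ≥ 2. Let G be the chain of onions of width b and length n, with spine vertices u₁,…,u_n. Let Σ′ be a disjoint copy of Σ (writing a′ for the copy of a), with color set Σ ∪ Σ′. Assign lists: l(u_i) = Σ for even i and l(u_i) = Σ′ for odd i; fix an enumeration (a_j, b_j), j = 1,…,b, of Σ² \ E_H, and set l(v_iʲ) = {a_j, b_j′} for even i and l(v_iʲ) = {a_j′, b_j} for odd i. For a proper list coloring c of G define its spine word w(c) ∈ Σⁿ by w(c)_i = a if c(u_i) ∈ {a, a′}. Then: (1) for every proper list coloring c, the word w(c) is an H-word; (2) two proper list colorings α and β are connected by a sequence of proper list colorings in which consecutive colorings differ at exactly one vertex, if and only if w(α) and w(β) are connected by H-word reconfiguration. -/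
/-- The chain of onions of width `b` and length `n`: spine vertices `u_{k+1} = Sum.inl k`
for `k : Fin n` (so `Sum.inl k` is the paper's `u_{k+1}`), onion vertices
`v_{i+1}ʲ = Sum.inr (i, j)` for `i : Fin (n-1)`, `j : Fin b`, with edges `u_{i+1} v_{i+1}ʲ`
and `v_{i+1}ʲ u_{i+2}`. -/
def onionChain (n b : ℕ) : SimpleGraph (Fin n ⊕ Fin (n - 1) × Fin b) :=
  SimpleGraph.fromRel fun x y =>
    ∃ (i : Fin (n - 1)) (j : Fin b) (k : Fin n),
      x = Sum.inl k ∧ y = Sum.inr (i, j) ∧ (k.val = i.val ∨ k.val = i.val + 1)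

/-- The color lists: the color set is `A ⊕ A`, where `Sum.inl a` is `a ∈ Σ` and
`Sum.inr a` is its primed copy `a′ ∈ Σ′`. The spine vertex `u_k` (1-indexed) gets the list
`Σ` for even `k` and `Σ′` for odd `k`; for the enumeration `(a_j, b_j)` of `Σ² \ E_H`, the
onion vertex `v_iʲ` (1-indexed) gets the list `{a_j, b_j′}` for even `i` and `{a_j′, b_j}`
for odd `i`. -/
def onionLists {A : Type*} (n b : ℕ) (pairs : Fin b → A × A) :
    (Fin n ⊕ Fin (n - 1) × Fin b) → Set (A ⊕ A)
  | Sum.inl k =>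
      if (k.val + 1) % 2 = 0 then Set.range Sum.inl else Set.range Sum.inr
  | Sum.inr (i, j) =>
      if (i.val + 1) % 2 = 0 then {Sum.inl (pairs j).1, Sum.inr (pairs j).2}
      else {Sum.inr (pairs j).1, Sum.inl (pairs j).2}

/-- A proper list coloring: every vertex gets a color from its list and adjacent vertices
get distinct colors. -/
def ProperListCol {V C : Type*} (G : SimpleGraph V) (l : V → Set C) (c : V → C) : Prop :=
  (∀ v, c v ∈ l v) ∧ ∀ u v, G.Adj u v → c u ≠ c v

/-- The spine word `w(c) ∈ Σⁿ` of a coloring, forgetting primes. -/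
def spineWord {A : Type*} (n b : ℕ) (c : (Fin n ⊕ Fin (n - 1) × Fin b) → A ⊕ A) :
    List A :=
  List.ofFn fun k : Fin n => Sum.elim id id (c (Sum.inl k))

/-- Two colorings differ at exactly one vertex. -/
def FDiffOne {V C : Type*} (f g : V → C) : Prop :=
  ∃ v, f v ≠ g v ∧ ∀ u, u ≠ v → f u = g u

open Relation

/-- If every mixture of `f` and `g` satisfies `P`, then `f` can be turned into `g` by changing
one value at a time while preserving `P`. -/
theorem reflTransGen_fDiffOne_of_piecewise {V C : Type*} [Fintype V] [DecidableEq V]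
    (P : (V → C) → Prop) (f g : V → C) (h : ∀ T : Finset V, P (T.piecewise g f)) :
    ReflTransGen (fun c c' => P c ∧ P c' ∧ FDiffOne c c') f g := by
  suffices key : ∀ T : Finset V,
      ReflTransGen (fun c c' => P c ∧ P c' ∧ FDiffOne c c') f (T.piecewise g f) by
    simpa using key Finset.univ
  intro T
  induction T using Finset.induction_on with
  | empty => simpa using ReflTransGen.refl
  | insert v T _ ih =>
    by_cases hv : T.piecewise g f v = g v
    · rwa [Finset.piecewise_insert, ← hv, Function.update_eq_self]
    · refine ih.tail ⟨h T, h _, v, ?_, fun u hu => ?_⟩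
      · rwa [Finset.piecewise_insert_self]
      · rw [Finset.piecewise_insert_of_ne (h := hu)]

theorem FDiffOne.oneDiff_ofFn {D : Type*} {n : ℕ} {f g : Fin n → D} (h : FDiffOne f g) :
    OneDiff (List.ofFn f) (List.ofFn g) := by
  obtain ⟨p, hp, hne⟩ := h
  have split_at : ∀ e : Fin n → D, List.ofFn e =
      (List.ofFn e).take p ++ e p :: (List.ofFn e).drop (p + 1) := by
    intro e
    have hlt : (p : ℕ) < (List.ofFn e).length := by simp
    conv_lhs => rw [← List.take_append_drop p (List.ofFn e), List.drop_eq_getElem_cons hlt]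
    simp
  refine ⟨(List.ofFn f).take p, f p, g p, (List.ofFn f).drop (p + 1), hp, split_at f, ?_⟩
  rw [split_at g]
  congr 1
  · refine List.ext_getElem (by simp) fun i h₁ h₂ => ?_
    simp only [List.length_take, List.length_ofFn] at h₁
    simp only [List.getElem_take, List.getElem_ofFn]
    exact (hne _ (Fin.ne_of_val_ne (by simp; omega))).symm
  · congr 1
    refine List.ext_getElem (by simp) fun i h₁ h₂ => ?_
    simp only [List.getElem_drop, List.getElem_ofFn]
    exact (hne _ (Fin.ne_of_val_ne (by simp; omega))).symm

theorem OneDiff.exists_ofFn {D : Type*} {n : ℕ} {f : Fin n → D} {w : List D}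
    (h : OneDiff (List.ofFn f) w) : ∃ g : Fin n → D, w = List.ofFn g ∧ FDiffOne f g := by
  obtain ⟨u, a, b, v, hab, hf, rfl⟩ := h
  have hlen : n = (u ++ a :: v).length := by rw [← hf, List.length_ofFn]
  have hu : u.length < n := by simp at hlen; omega
  have hfk : ∀ k : Fin n, f k = (u ++ a :: v)[(k : ℕ)]'(hlen ▸ k.2) := by
    intro k
    simp [← hf]
  refine ⟨fun k => (u ++ b :: v)[(k : ℕ)]'(by have := k.2; simp at hlen ⊢; omega), ?_,
    ⟨u.length, hu⟩, ?_, fun k hk => ?_⟩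
  · exact List.ext_getElem (by simp at hlen ⊢; omega) fun i h₁ h₂ => by simp
  · simpa [hfk] using hab
  · have hk' : (k : ℕ) ≠ u.length := fun h => hk (Fin.ext h)
    rw [hfk]
    simp only [List.getElem_append, List.getElem_cons]
    split_ifs <;> first | rfl | omega

namespace OnionChain

variable {A : Type*} {n b : ℕ}

/-- The spine vertex preceding the `i`-th onion. -/
def leftEnd (i : Fin (n - 1)) : Fin n := ⟨i, by omega⟩

/-- The spine vertex following the `i`-th onion. -/
def rightEnd (i : Fin (n - 1)) : Fin n := ⟨i + 1, by omega⟩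

/-- The copy of the letter `a` which is available at the spine vertex with index `k`. -/
def tag (k : ℕ) (a : A) : A ⊕ A := if (k + 1) % 2 = 0 then Sum.inl a else Sum.inr a

theorem tag_inj {k : ℕ} {a c : A} : tag k a = tag k c ↔ a = c := by
  unfold tag; split_ifs <;> simp

theorem tag_succ_ne (k : ℕ) (a c : A) : tag (k + 1) a ≠ tag k c := by
  unfold tag; split_ifs <;> first | omega | simp

@[simp] theorem elim_tag (k : ℕ) (a : A) : Sum.elim id id (tag k a) = a := by
  unfold tag; split_ifs <;> rfl

theorem adj_inl_inr {k : Fin n} {i : Fin (n - 1)} {j : Fin b} :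
    (onionChain n b).Adj (Sum.inl k) (Sum.inr (i, j)) ↔ k = leftEnd i ∨ k = rightEnd i := by
  simp only [onionChain, SimpleGraph.fromRel_adj, leftEnd, rightEnd, Fin.ext_iff]
  constructor
  · rintro ⟨-, ⟨i', j', k', hk, hv, h⟩ | ⟨_, _, _, h, -⟩⟩
    · cases hk; cases hv; exact h
    · cases h
  · exact fun h => ⟨Sum.inl_ne_inr, Or.inl ⟨i, j, k, rfl, rfl, h⟩⟩

theorem not_adj_inl_inl {k k' : Fin n} :
    ¬ (onionChain n b).Adj (Sum.inl k) (Sum.inl k') := by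
  simp [onionChain, SimpleGraph.fromRel_adj]

theorem not_adj_inr_inr {x y : Fin (n - 1) × Fin b} :
    ¬ (onionChain n b).Adj (Sum.inr x) (Sum.inr y) := by
  simp [onionChain, SimpleGraph.fromRel_adj]

theorem mem_onionLists_inl {pairs : Fin b → A × A} {k : Fin n} {x : A ⊕ A} :
    x ∈ onionLists n b pairs (Sum.inl k) ↔ x = tag k (Sum.elim id id x) := by
  unfold onionLists tag
  dsimp only
  split_ifs <;> cases x <;> simp

theorem mem_onionLists_inr {pairs : Fin b → A × A} {i : Fin (n - 1)} {j : Fin b} {x : A ⊕ A} :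
    x ∈ onionLists n b pairs (Sum.inr (i, j)) ↔
      x = tag i (pairs j).1 ∨ x = tag (i + 1) (pairs j).2 := by
  unfold onionLists tag
  dsimp only
  split_ifs <;> first | omega | simp

/-- The letter of the spine word of `c` at position `k`. -/
def letter (c : Fin n ⊕ Fin (n - 1) × Fin b → A ⊕ A) (k : Fin n) : A :=
  Sum.elim id id (c (Sum.inl k))

theorem spineWord_eq (c : Fin n ⊕ Fin (n - 1) × Fin b → A ⊕ A) :
    spineWord n b c = List.ofFn (letter c) := rfl

/-- The color `x` is admissible for the `j`-th vertex of the `i`-th onion when the spine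
carries the letters `f`. -/
def Admissible (pairs : Fin b → A × A) (f : Fin n → A) (i : Fin (n - 1)) (j : Fin b)
    (x : A ⊕ A) : Prop :=
  x = tag i (pairs j).1 ∧ f (leftEnd i) ≠ (pairs j).1 ∨
    x = tag (i + 1) (pairs j).2 ∧ f (rightEnd i) ≠ (pairs j).2

theorem properListCol_iff {pairs : Fin b → A × A} {c : Fin n ⊕ Fin (n - 1) × Fin b → A ⊕ A} :
    ProperListCol (onionChain n b) (onionLists n b pairs) c ↔
      (∀ k, c (Sum.inl k) = tag k (letter c k)) ∧
        ∀ i j, Admissible pairs (letter c) i j (c (Sum.inr (i, j))) := by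
  constructor
  · rintro ⟨hl, hadj⟩
    have hs : ∀ k, c (Sum.inl k) = tag k (letter c k) := fun k => mem_onionLists_inl.1 (hl _)
    refine ⟨hs, fun i j => ?_⟩
    have h₁ := hadj _ _ (adj_inl_inr (j := j).2 (Or.inl (rfl : leftEnd i = _)))
    have h₂ := hadj _ _ (adj_inl_inr (j := j).2 (Or.inr (rfl : rightEnd i = _)))
    rw [hs] at h₁ h₂
    refine (mem_onionLists_inr.1 (hl (Sum.inr (i, j)))).imp (fun h => ⟨h, ?_⟩)
      (fun h => ⟨h, ?_⟩)
    · rintro e; rw [h, e] at h₁; exact h₁ rfl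
    · rintro e; rw [h, e] at h₂; exact h₂ rfl
  · rintro ⟨hs, ha⟩
    have key : ∀ k i j, (onionChain n b).Adj (Sum.inl k) (Sum.inr (i, j)) →
        c (Sum.inl k) ≠ c (Sum.inr (i, j)) := by
      intro k i j h
      rw [hs]
      rcases adj_inl_inr.1 h with rfl | rfl <;> rcases ha i j with ⟨h, hne⟩ | ⟨h, hne⟩ <;> rw [h]
      · exact fun e => hne (tag_inj.1 e)
      · exact (tag_succ_ne _ _ _).symm
      · exact tag_succ_ne _ _ _
      · exact fun e => hne (tag_inj.1 e)
    refine ⟨?_, ?_⟩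
    · rintro (k | ⟨i, j⟩)
      · exact mem_onionLists_inl.2 (hs k)
      · exact mem_onionLists_inr.2 ((ha i j).imp And.left And.left)
    · rintro (k | ⟨i, j⟩) (k' | ⟨i', j'⟩) h
      · exact absurd h not_adj_inl_inl
      · exact key _ _ _ h
      · exact (key _ _ _ h.symm).symm
      · exact absurd h not_adj_inr_inr

theorem isChain_spineWord {E : A → A → Prop} {pairs : Fin b → A × A}
    (hpairs : ∀ a c : A, ¬E a c ↔ ∃ j : Fin b, pairs j = (a, c))
    {c : Fin n ⊕ Fin (n - 1) × Fin b → A ⊕ A}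
    (hc : ProperListCol (onionChain n b) (onionLists n b pairs) c) :
    (spineWord n b c).IsChain E := by
  rw [spineWord_eq, List.isChain_ofFn]
  intro i hi
  by_contra hE
  obtain ⟨j, hj⟩ := (hpairs _ _).1 hE
  rcases (properListCol_iff.1 hc).2 ⟨i, by omega⟩ j with ⟨-, h⟩ | ⟨-, h⟩ <;>
    exact h (by rw [hj]; rfl)

theorem letter_eq_or_fDiffOne {pairs : Fin b → A × A}
    {c c' : Fin n ⊕ Fin (n - 1) × Fin b → A ⊕ A}
    (hc : ProperListCol (onionChain n b) (onionLists n b pairs) c)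
    (hc' : ProperListCol (onionChain n b) (onionLists n b pairs) c') (h : FDiffOne c c') :
    letter c = letter c' ∨ FDiffOne (letter c) (letter c') := by
  obtain ⟨k | x, hv, hne⟩ := h
  · refine Or.inr ⟨k, fun e => hv ?_, fun u hu => ?_⟩
    · rw [(properListCol_iff.1 hc).1, (properListCol_iff.1 hc').1, e]
    · simp [letter, hne (Sum.inl u) (by simpa using hu)]
  · refine Or.inl (funext fun u => ?_)
    simp [letter, hne (Sum.inl u) (by simp)]

theorem reachable_of_letter_eq {pairs : Fin b → A × A}
    {c c' : Fin n ⊕ Fin (n - 1) × Fin b → A ⊕ A}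
    (hc : ProperListCol (onionChain n b) (onionLists n b pairs) c)
    (hc' : ProperListCol (onionChain n b) (onionLists n b pairs) c')
    (h : letter c = letter c') :
    ReflTransGen (fun c c' => ProperListCol (onionChain n b) (onionLists n b pairs) c ∧
      ProperListCol (onionChain n b) (onionLists n b pairs) c' ∧ FDiffOne c c') c c' := by
  refine reflTransGen_fDiffOne_of_piecewise _ c c' fun T => ?_
  rw [properListCol_iff] at hc hc' ⊢
  have hT : ∀ k : Fin n, T.piecewise c' c (Sum.inl k) = c (Sum.inl k) := by
    intro k
    rw [Finset.piecewise]
    split_ifs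
    · rw [hc.1, hc'.1, h]
    · rfl
  have hl : letter (T.piecewise c' c) = letter c := funext fun k => by rw [letter, hT, letter]
  rw [hl]
  refine ⟨fun k => by rw [hT, hc.1], fun i j => ?_⟩
  rw [Finset.piecewise]
  split_ifs
  · rw [h]; exact hc'.2 i j
  · exact hc.2 i j

/-- Words that differ in at most one position leave, in every onion vertex, a color that is
admissible for both. -/
theorem exists_admissible {E : A → A → Prop} {pairs : Fin b → A × A}
    (hpairs : ∀ a c : A, ¬E a c ↔ ∃ j : Fin b, pairs j = (a, c)) {f g : Fin n → A}
    (hf : (List.ofFn f).IsChain E) (hg : (List.ofFn g).IsChain E) (hfg : FDiffOne f g)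
    (i : Fin (n - 1)) (j : Fin b) :
    ∃ x, Admissible pairs f i j x ∧ Admissible pairs g i j x := by
  rw [List.isChain_ofFn] at hf hg
  have hf' : E (f (leftEnd i)) (f (rightEnd i)) := hf i (by omega)
  have hg' : E (g (leftEnd i)) (g (rightEnd i)) := hg i (by omega)
  have hj : ¬E (pairs j).1 (pairs j).2 := (hpairs _ _).2 ⟨j, rfl⟩
  have hagree : f (leftEnd i) = g (leftEnd i) ∨ f (rightEnd i) = g (rightEnd i) := by
    obtain ⟨p, -, hp⟩ := hfg
    by_cases h : leftEnd i = p
    · refine Or.inr (hp _ ?_)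
      rw [← h]
      simp [leftEnd, rightEnd]
    · exact Or.inl (hp _ h)
  by_cases h₁ : f (leftEnd i) ≠ (pairs j).1 ∧ g (leftEnd i) ≠ (pairs j).1
  · exact ⟨_, Or.inl ⟨rfl, h₁.1⟩, Or.inl ⟨rfl, h₁.2⟩⟩
  by_cases h₂ : f (rightEnd i) ≠ (pairs j).2 ∧ g (rightEnd i) ≠ (pairs j).2
  · exact ⟨_, Or.inr ⟨rfl, h₂.1⟩, Or.inr ⟨rfl, h₂.2⟩⟩
  grind

/-- The coloring with spine letters `f` and onion colors `x`. -/
def coloring (f : Fin n → A) (x : Fin (n - 1) → Fin b → A ⊕ A) :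
    Fin n ⊕ Fin (n - 1) × Fin b → A ⊕ A :=
  Sum.elim (fun k => tag k (f k)) fun p => x p.1 p.2

@[simp] theorem letter_coloring (f : Fin n → A) (x : Fin (n - 1) → Fin b → A ⊕ A) :
    letter (coloring f x) = f := by
  ext k; simp [letter, coloring]

theorem properListCol_coloring {pairs : Fin b → A × A} {f : Fin n → A}
    {x : Fin (n - 1) → Fin b → A ⊕ A} (h : ∀ i j, Admissible pairs f i j (x i j)) :
    ProperListCol (onionChain n b) (onionLists n b pairs) (coloring f x) := by
  rw [properListCol_iff, letter_coloring]
  exact ⟨fun _ => rfl, h⟩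

theorem fDiffOne_coloring {f g : Fin n → A} (h : FDiffOne f g)
    (x : Fin (n - 1) → Fin b → A ⊕ A) : FDiffOne (coloring f x) (coloring g x) := by
  obtain ⟨p, hp, hne⟩ := h
  refine ⟨Sum.inl p, fun e => hp (tag_inj.1 e), ?_⟩
  rintro (k | y) hk
  · exact congrArg (tag k) (hne k (by simpa using hk))
  · rfl

theorem exists_reachable {E : A → A → Prop} {pairs : Fin b → A × A}
    (hpairs : ∀ a c : A, ¬E a c ↔ ∃ j : Fin b, pairs j = (a, c))
    {α : Fin n ⊕ Fin (n - 1) × Fin b → A ⊕ A}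
    (hα : ProperListCol (onionChain n b) (onionLists n b pairs) α) {w : List A}
    (h : ReflTransGen (HWordAdj E) (spineWord n b α) w) :
    ∃ γ, ProperListCol (onionChain n b) (onionLists n b pairs) γ ∧ spineWord n b γ = w ∧
      ReflTransGen (fun c c' => ProperListCol (onionChain n b) (onionLists n b pairs) c ∧
        ProperListCol (onionChain n b) (onionLists n b pairs) c' ∧ FDiffOne c c') α γ := by
  induction h with
  | refl => exact ⟨α, hα, rfl, .refl⟩
  | tail _ hstep ih =>
    obtain ⟨γ, hγ, rfl, hreach⟩ := ih
    obtain ⟨hw, hw', hd⟩ := hstep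
    obtain ⟨g, rfl, hfg⟩ := OneDiff.exists_ofFn hd
    choose x hx hx' using exists_admissible hpairs hw hw' hfg
    have hf := properListCol_coloring hx
    have hg := properListCol_coloring hx'
    exact ⟨coloring g x, hg, by rw [spineWord_eq, letter_coloring],
      (hreach.trans (reachable_of_letter_eq hγ hf (letter_coloring _ _).symm)).tail
        ⟨hf, hg, fDiffOne_coloring hfg x⟩⟩

end OnionChain

open OnionChain

/-- (1) The spine word of every proper list coloring of the chain of onions is an
`H`-word. (2) Two proper list colorings are connected by single-vertex recolorings through
proper list colorings iff their spine words are connected by `H`-word reconfiguration. -/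
theorem stmt11 {A : Type*} (E : A → A → Prop) (b n : ℕ) (hn : 2 ≤ n)
    (pairs : Fin b → A × A) (hinj : Function.Injective pairs)
    (hpairs : ∀ a c : A, ¬E a c ↔ ∃ j : Fin b, pairs j = (a, c)) :
    (∀ c, ProperListCol (onionChain n b) (onionLists n b pairs) c →
      (spineWord n b c).Chain' E) ∧
    (∀ α β, ProperListCol (onionChain n b) (onionLists n b pairs) α →
      ProperListCol (onionChain n b) (onionLists n b pairs) β →
      (Relation.ReflTransGen
          (fun c c' => ProperListCol (onionChain n b) (onionLists n b pairs) c ∧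
            ProperListCol (onionChain n b) (onionLists n b pairs) c' ∧ FDiffOne c c')
          α β ↔
        Relation.ReflTransGen (HWordAdj E) (spineWord n b α) (spineWord n b β))) := by
  refine ⟨fun c hc => isChain_spineWord hpairs hc, fun α β hα hβ => ⟨fun h => ?_, fun h => ?_⟩⟩
  · refine ReflTransGen.lift' (spineWord n b) (fun c c' ⟨hc, hc', hd⟩ => ?_) _ _ h
    change ReflTransGen _ (spineWord n b c) (spineWord n b c')
    rcases letter_eq_or_fDiffOne hc hc' hd with he | hd
    · rw [spineWord_eq, spineWord_eq, he]
    · exact .single ⟨isChain_spineWord hpairs hc, isChain_spineWord hpairs hc', hd.oneDiff_ofFn⟩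
  · obtain ⟨γ, hγ, hw, hreach⟩ := exists_reachable hpairs hα h
    exact hreach.trans (reachable_of_letter_eq hγ hβ (List.ofFn_injective hw))
end
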